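/- arXiv:2312.04653 — 5 statements merged into one kernel-verified Lean document; each statement's English description precedes it below -/
import Mathlib

section
/- Let ε > 0 and L > 0, and let U : [0,1] → ℝ be L-left-Lipschitz, i.e. U(y) − U(x) ≥ −L(y−x) for all 0 ≤ x ≤ y ≤ 1. Let Γ = ({k·ε/L : k ∈ ℕ} ∩ [0,1]) ∪ {1} be the grid of multiples of ε/L in [0,1] together with the point 1. Suppose Û : Γ → ℝ satisfies |Û(γ) − U(γ)| ≤ ε for every γ ∈ Γ, and let γ̂ ∈ Γ be a point maximizing Û over Γ. Then U(γ̂) ≥ sup_{γ∈[0,1]} U(γ) − 3ε. -/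
open Set

/-- Every point of `[0, 1]` has a point of the grid of step `d`, or the endpoint `1`, at
distance at most `d` to its right. -/
theorem exists_grid_point_ge {d x : ℝ} (hd : 0 < d) (hx : x ∈ Icc (0 : ℝ) 1) :
    ∃ y ∈ ({x : ℝ | ∃ k : ℕ, x = k * d} ∩ Icc (0 : ℝ) 1) ∪ {1},
      x ≤ y ∧ y ≤ 1 ∧ y - x ≤ d := by
  have hle : x ≤ ⌈x / d⌉₊ * d := (div_le_iff₀ hd).mp (Nat.le_ceil _)
  have hlt : ⌈x / d⌉₊ * d < x + d := by
    have h := mul_lt_mul_of_pos_right (Nat.ceil_lt_add_one (div_nonneg hx.1 hd.le)) hd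
    rwa [add_mul, div_mul_cancel₀ _ hd.ne', one_mul] at h
  rcases le_total (⌈x / d⌉₊ * d) 1 with h1 | h1
  · exact ⟨_, Or.inl ⟨⟨_, rfl⟩, hx.1.trans hle, h1⟩, hle, h1, by linarith⟩
  · exact ⟨1, Or.inr rfl, hx.2, le_rfl, by linarith⟩

/-- Discretization step for a left-Lipschitz utility: the empirical maximizer over the
grid of multiples of `ε/L` (together with `1`) is `3ε`-optimal. -/
theorem stmt_2 (ε L : ℝ) (hε : 0 < ε) (hL : 0 < L) (U : ℝ → ℝ)
    (hU_lip : ∀ x y, 0 ≤ x → x ≤ y → y ≤ 1 → U y - U x ≥ -L * (y - x))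
    (Γ : Set ℝ)
    (hΓ : Γ = ({x : ℝ | ∃ k : ℕ, x = k * (ε / L)} ∩ Icc (0:ℝ) 1) ∪ {1})
    (Uhat : ℝ → ℝ)
    (hUhat : ∀ γ ∈ Γ, |Uhat γ - U γ| ≤ ε)
    (γhat : ℝ) (hγhat : γhat ∈ Γ) (hmax : ∀ γ ∈ Γ, Uhat γ ≤ Uhat γhat) :
    U γhat ≥ sSup (U '' Icc (0:ℝ) 1) - 3 * ε := by
  suffices h : sSup (U '' Icc (0:ℝ) 1) ≤ U γhat + 3 * ε by linarith
  refine csSup_le ((nonempty_Icc.mpr zero_le_one).image U) ?_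
  rintro _ ⟨x, hx, rfl⟩
  obtain ⟨y, hy, hxy, hy1, hyd⟩ := exists_grid_point_ge (div_pos hε hL) hx
  rw [← hΓ] at hy
  have hlip := hU_lip x y hx.1 hxy hy1
  have hstep : L * (y - x) ≤ ε := by
    rwa [le_div_iff₀' hL] at hyd
  have hy_est := abs_le.mp (hUhat y hy)
  have hhat_est := abs_le.mp (hUhat γhat hγhat)
  linarith [hmax y hy, hy_est.1, hhat_est.2]
end

section
/- Fix α ∈ (1/2, 9/16). Let μ_α be the probability measure on [0,1] with point mass 1/8 at 1/2, density 3/(16v²) on (1/2, α), point mass 3/(16α) at α, and point mass 1/2 at 1, and let g_α(γ,v) = γ if v < 15/16, g_α(γ,v) = v − 3/8 if v ≥ 15/16 and γ < α, and g_α(γ,v) = v if v ≥ 15/16 and γ ≥ α. Define the expected utility U_α(γ) = ∫ g_α(γ,v)·1_{v≥γ} dμ_α(v). Then U_α(α) = 11/16, and for every γ ∈ [0,1] with γ ≠ α one has U_α(γ) ≤ 9/16; in particular U_α(α) − U_α(γ) ≥ 1/8 for all γ ≠ α, so α is the unique maximizer of U_α. -/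
open MeasureTheory Set

lemma continuousOn_density {a b : ℝ} (ha : 0 < a) :
    ContinuousOn (fun v : ℝ => 3 / (16 * v ^ 2)) (Icc a b) := by
  refine ContinuousOn.div (by fun_prop) (by fun_prop) fun v hv => ?_
  have : 0 < v := ha.trans_le hv.1
  positivity

lemma integral_density {a b : ℝ} (ha : 0 < a) (hab : a ≤ b) :
    ∫ v in Ioc a b, 3 / (16 * v ^ 2) = 3 / 16 * (1 / a - 1 / b) := by
  rw [← intervalIntegral.integral_of_le hab]
  have hderiv : ∀ v ∈ uIcc a b,
      HasDerivAt (fun v : ℝ => -(3 / 16) * v⁻¹) (3 / (16 * v ^ 2)) v := by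
    intro v hv
    rw [uIcc_of_le hab] at hv
    have hv0 : v ≠ 0 := (ha.trans_le hv.1).ne'
    refine ((hasDerivAt_inv hv0).const_mul (-(3 / 16) : ℝ)).congr_deriv ?_
    field_simp
  have hint : IntervalIntegrable (fun v : ℝ => 3 / (16 * v ^ 2)) volume a b := by
    apply ContinuousOn.intervalIntegrable
    rw [uIcc_of_le hab]
    exact continuousOn_density ha
  rw [intervalIntegral.integral_eq_sub_of_hasDerivAt hderiv hint]
  ring

/-- The absolutely continuous part of the value distribution. -/
noncomputable def continuousPart (α : ℝ) : Measure ℝ :=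
  (volume.restrict (Ioo (1/2 : ℝ) α)).withDensity (fun v => ENNReal.ofReal (3 / (16 * v ^ 2)))

instance (α : ℝ) : IsFiniteMeasure (continuousPart α) := by
  apply isFiniteMeasure_withDensity_ofReal
  have h : IntegrableOn (fun v : ℝ => 3 / (16 * v ^ 2)) (Ioo (1/2) α) :=
    ((continuousOn_density (by norm_num)).integrableOn_Icc).mono_set Ioo_subset_Icc_self
  exact h.2

lemma integral_continuousPart (α γ : ℝ) :
    ∫ v, (Ici γ).indicator (fun _ => γ) v ∂(continuousPart α)
      = γ * ∫ v in Ioo (1/2) α ∩ Ici γ, 3 / (16 * v ^ 2) := by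
  rw [continuousPart, integral_withDensity_eq_integral_toReal_smul (by fun_prop) (by simp),
    ← integral_const_mul, ← setIntegral_indicator measurableSet_Ici]
  congr 1 with v
  by_cases hv : v ∈ Ici γ
  · have : (0 : ℝ) ≤ 3 / (16 * v ^ 2) := by positivity
    simp only [indicator_of_mem hv, ENNReal.toReal_ofReal this, smul_eq_mul]
    ring
  · simp [indicator_of_notMem hv]

lemma integral_mixture {a b c : ℝ} (ha : 0 ≤ a) (hb : 0 ≤ b) (hc : 0 ≤ c) {x y z : ℝ}
    {ν : Measure ℝ} {f : ℝ → ℝ} (hf : Integrable f ν) :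
    ∫ v, f v ∂(ENNReal.ofReal a • Measure.dirac x + ν + ENNReal.ofReal b • Measure.dirac y
        + ENNReal.ofReal c • Measure.dirac z)
      = a * f x + ∫ v, f v ∂ν + b * f y + c * f z := by
  have hd : ∀ r t : ℝ, Integrable f (ENNReal.ofReal r • Measure.dirac t) := fun r t =>
    (integrable_dirac (by simp)).smul_measure ENNReal.ofReal_ne_top
  rw [integral_add_measure (((hd a x).add_measure hf).add_measure (hd b y)) (hd c z),
    integral_add_measure ((hd a x).add_measure hf) (hd b y),
    integral_add_measure (hd a x) hf]
  simp [integral_smul_measure, ENNReal.toReal_ofReal, ha, hb, hc]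

/-- Key property of the impossibility construction: for the value distribution `μ_α` and the
reward function `g_α`, the expected utility `U_α(γ) = ∫ g_α(γ,v)·1_{v ≥ γ} dμ_α(v)` satisfies
`U_α(α) = 11/16` and `U_α(γ) ≤ 9/16` for every `γ ≠ α`; in particular the gap is at least
`1/8`, so `α` is the unique maximizer. -/
theorem stmt_6 (α : ℝ) (hα : α ∈ Ioo (1/2 : ℝ) (9/16))
    (μ : Measure ℝ)
    (hμ : μ = (ENNReal.ofReal (1/8)) • Measure.dirac (1/2 : ℝ)
      + (volume.restrict (Ioo (1/2 : ℝ) α)).withDensity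
          (fun v => ENNReal.ofReal (3 / (16 * v ^ 2)))
      + (ENNReal.ofReal (3 / (16 * α))) • Measure.dirac α
      + (ENNReal.ofReal (1/2)) • Measure.dirac (1 : ℝ))
    (g : ℝ → ℝ → ℝ)
    (hg : ∀ γ v, g γ v = if v < 15/16 then γ else if γ < α then v - 3/8 else v)
    (U : ℝ → ℝ)
    (hU : ∀ γ, U γ = ∫ v, (if γ ≤ v then g γ v else 0) ∂μ) :
    U α = 11/16
    ∧ (∀ γ ∈ Icc (0:ℝ) 1, γ ≠ α → U γ ≤ 9/16)
    ∧ (∀ γ ∈ Icc (0:ℝ) 1, γ ≠ α → 1/8 ≤ U α - U γ) := by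
  obtain ⟨h1, h2⟩ := hα
  have h0 : 0 < α := by linarith
  have key : ∀ γ, U γ = 1/8 * (if γ ≤ 1/2 then γ else 0)
      + γ * (∫ v in Ioo (1/2) α ∩ Ici γ, 3 / (16 * v ^ 2))
      + 3 / (16 * α) * (if γ ≤ α then γ else 0)
      + 1/2 * (if γ ≤ 1 then (if γ < α then 5/8 else 1) else 0) := by
    intro γ
    have hae : (Ici γ).indicator (fun _ => γ) =ᵐ[continuousPart α]
        fun v => if γ ≤ v then g γ v else 0 := by
      refine (withDensity_absolutelyContinuous _ _).ae_le ?_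
      filter_upwards [ae_restrict_mem measurableSet_Ioo] with v hv
      have : v < 15/16 := by linarith [hv.2]
      simp [indicator_apply, hg, this]
    have hint : Integrable ((Ici γ).indicator fun _ => γ) (continuousPart α) :=
      (integrable_const γ).indicator measurableSet_Ici
    rw [hU, hμ, ← continuousPart, integral_mixture (by norm_num) (by positivity) (by norm_num)
      (hint.congr hae), ← integral_congr_ae hae, integral_continuousPart]
    have h3 : α < 15/16 := by linarith
    have h4 : (1/2 : ℝ) < 15/16 := by norm_num
    have h5 : ¬ (1 : ℝ) < 15/16 := by norm_num
    simp only [hg, h3, h4, h5, if_true, if_false]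
    norm_num
  have hmax : U α = 11/16 := by
    have hempty : Ioo (1/2) α ∩ Ici α = ∅ := by
      ext v
      simp only [mem_inter_iff, mem_Ioo, mem_Ici, mem_empty_iff_false, iff_false]
      rintro ⟨⟨_, h⟩, h'⟩
      linarith
    rw [key, hempty, if_neg (by linarith), if_pos le_rfl, if_pos (by linarith),
      if_neg (lt_irrefl α)]
    simp only [Measure.restrict_empty, integral_zero_measure]
    field_simp
    norm_num
  have hle : ∀ γ ∈ Icc (0:ℝ) 1, γ ≠ α → U γ ≤ 9/16 := by
    intro γ hγ hne
    rw [key, if_pos hγ.2]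
    rcases lt_or_gt_of_ne hne with hlt | hgt
    · rw [if_pos hlt.le, if_pos hlt]
      rcases le_or_gt γ (1/2) with hhalf | hhalf
      · have hset : Ioo (1/2) α ∩ Ici γ = Ioo (1/2) α :=
          inter_eq_left.2 fun v hv => hhalf.trans hv.1.le
        rw [if_pos hhalf, hset, ← integral_Ioc_eq_integral_Ioo,
          integral_density (by norm_num) h1.le]
        have : 1/8 * γ + γ * (3/16 * (1 / (1/2) - 1/α)) + 3 / (16 * α) * γ = γ / 2 := by
          field_simp
          ring
        linarith
      · have hset : Ioo (1/2) α ∩ Ici γ = Ico γ α := by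
          ext v
          simp only [mem_inter_iff, mem_Ioo, mem_Ici, mem_Ico]
          exact ⟨fun h => ⟨h.2, h.1.2⟩, fun h => ⟨⟨hhalf.trans_le h.1, h.2⟩, h.1⟩⟩
        have hpos : 0 < γ := by linarith
        rw [if_neg hhalf.not_ge, hset, integral_Ico_eq_integral_Ioo,
          ← integral_Ioc_eq_integral_Ioo, integral_density hpos hlt.le]
        have : γ * (3/16 * (1/γ - 1/α)) + 3 / (16 * α) * γ = 3/16 := by
          field_simp
          ring
        linarith
    · have hempty : Ioo (1/2) α ∩ Ici γ = ∅ := by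
        ext v
        simp only [mem_inter_iff, mem_Ioo, mem_Ici, mem_empty_iff_false, iff_false]
        rintro ⟨⟨_, h⟩, h'⟩
        linarith
      rw [hempty, if_neg (by linarith), if_neg hgt.not_ge, if_neg hgt.not_gt]
      simp only [Measure.restrict_empty, integral_zero_measure]
      norm_num
  exact ⟨hmax, hle, fun γ hγ hne => by linarith [hle γ hγ hne]⟩
end

section
/- Define F₀ : [0,1] → [0,1] by F₀(v) = (3/4)v for v ∈ [0, 1/3), F₀(v) = 1 − 1/(4v) for v ∈ [1/3, 1/2], and F₀(v) = v for v ∈ (1/2, 1], and define U₀(γ) = γ(1 − F₀(γ)) for γ ∈ [0,1]. Then U₀(γ) = 1/4 for every γ ∈ [1/3, 1/2], and U₀(γ) < 1/4 for every γ ∈ [0, 1/3) ∪ (1/2, 1]. In particular, the set of maximizers of U₀ on [0,1] is exactly the interval [1/3, 1/2]. -/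
open Set

/-- The base utility curve `U₀(γ) = γ(1 − F₀(γ))` equals `1/4` exactly on the plateau
`[1/3, 1/2]`, is strictly below `1/4` elsewhere on `[0,1]`, and its set of maximizers on
`[0,1]` is exactly `[1/3, 1/2]`. -/
theorem stmt_9 (F₀ U₀ : ℝ → ℝ)
    (hF₀ : ∀ v, F₀ v =
      if v < 1/3 then 3/4 * v else if v ≤ 1/2 then 1 - 1/(4*v) else v)
    (hU₀ : ∀ γ, U₀ γ = γ * (1 - F₀ γ)) :
    (∀ γ ∈ Icc (1/3 : ℝ) (1/2), U₀ γ = 1/4)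
    ∧ (∀ γ ∈ Icc (0:ℝ) 1, γ ∉ Icc (1/3 : ℝ) (1/2) → U₀ γ < 1/4)
    ∧ {γ ∈ Icc (0:ℝ) 1 | ∀ γ' ∈ Icc (0:ℝ) 1, U₀ γ' ≤ U₀ γ} = Icc (1/3 : ℝ) (1/2) := by
  have plateau : ∀ γ ∈ Icc (1/3 : ℝ) (1/2), U₀ γ = 1/4 := by
    rintro γ ⟨h₁, h₂⟩
    have hγ : γ ≠ 0 := by linarith
    rw [hU₀, hF₀, if_neg (not_lt.mpr h₁), if_pos h₂]
    field_simp
    ring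
  have off_plateau : ∀ γ ∈ Icc (0:ℝ) 1, γ ∉ Icc (1/3 : ℝ) (1/2) → U₀ γ < 1/4 := by
    rintro γ ⟨h₀, h₁⟩ hγ
    rw [hU₀, hF₀]
    by_cases h : γ < 1/3
    · rw [if_pos h]
      nlinarith [mul_pos (sub_pos.mpr h) (show 0 < 1 - γ by linarith)]
    · have h' : 1/2 < γ := by
        by_contra! hle
        exact hγ ⟨not_lt.mp h, hle⟩
      rw [if_neg h, if_neg (not_le.mpr h')]
      nlinarith [mul_pos (sub_pos.mpr h') (sub_pos.mpr h')]
  refine ⟨plateau, off_plateau, ?_⟩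
  ext γ
  constructor
  · rintro ⟨hγ, hmax⟩
    by_contra hn
    have hle := hmax (1/2) (by norm_num)
    rw [plateau (1/2) (by norm_num)] at hle
    exact (off_plateau γ hγ hn).not_ge hle
  · intro hγ
    refine ⟨⟨by linarith [hγ.1], by linarith [hγ.2]⟩, fun γ' hγ' => ?_⟩
    rw [plateau γ hγ]
    by_cases h : γ' ∈ Icc (1/3 : ℝ) (1/2)
    · exact (plateau γ' h).le
    · exact (off_plateau γ' hγ' h).le
end

section
/- Let w and ε satisfy ε > 0, w − 3ε ≥ 1/3, and w + 3ε ≤ 1/2. Define F₀(v) = (3/4)v on [0,1/3), F₀(v) = 1 − 1/(4v) on [1/3,1/2], F₀(v) = v on (1/2,1], and define F_{w,ε}(v) = F₀(v) − (v − w + 3ε) for v ∈ [w−3ε, w), F_{w,ε}(v) = F₀(v) − (w + 3ε − v) for v ∈ [w, w+3ε], and F_{w,ε}(v) = F₀(v) otherwise. Let U_{w,ε}(γ) = γ(1 − F_{w,ε}(γ)) for γ ∈ [0,1]. Then: (i) U_{w,ε}(w) = 1/4 + 3wε; (ii) U_{w,ε}(γ) < U_{w,ε}(w) for every γ ∈ [0,1]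 with γ ≠ w, so w is the unique maximizer of U_{w,ε}; and (iii) U_{w,ε}(w) > 1/4 + ε. -/
open Set

/-- On the plateau `[1/3, 1/2]`, subtracting `d` from `1 - 1/(4γ)` adds `γ * d` to the utility. -/
theorem plateau_utility {γ : ℝ} (hγ : γ ≠ 0) (d : ℝ) :
    γ * (1 - (1 - 1/(4*γ) - d)) = 1/4 + γ * d := by
  field_simp
  ring

/-- The perturbed utility `U_{w,ε}(γ) = γ(1 − F_{w,ε}(γ))` satisfies
`U_{w,ε}(w) = 1/4 + 3wε`, has `w` as its unique maximizer on `[0,1]`, and its maximum value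
exceeds `1/4 + ε`. -/
theorem stmt_13 (w ε : ℝ) (hε : 0 < ε) (h1 : 1/3 ≤ w - 3*ε) (h2 : w + 3*ε ≤ 1/2)
    (F₀ F U : ℝ → ℝ)
    (hF₀ : ∀ v, F₀ v =
      if v < 1/3 then 3/4 * v else if v ≤ 1/2 then 1 - 1/(4*v) else v)
    (hF : ∀ v, F v =
      if v ∈ Ico (w - 3*ε) w then F₀ v - (v - w + 3*ε)
      else if v ∈ Icc w (w + 3*ε) then F₀ v - (w + 3*ε - v)
      else F₀ v)
    (hU : ∀ γ, U γ = γ * (1 - F γ)) :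
    U w = 1/4 + 3*w*ε
    ∧ (∀ γ ∈ Icc (0:ℝ) 1, γ ≠ w → U γ < U w)
    ∧ U w > 1/4 + ε := by
  have hplateau : ∀ v, 1/3 ≤ v → v ≤ 1/2 → F₀ v = 1 - 1/(4*v) := fun v hv hv' => by
    rw [hF₀, if_neg hv.not_gt, if_pos hv']
  have hUw : U w = 1/4 + 3*w*ε := by
    have hFw : F w = 1 - 1/(4*w) - 3*ε := by
      rw [hF, if_neg (fun h => lt_irrefl _ h.2), if_pos ⟨le_rfl, by linarith⟩,
        hplateau w (by linarith) (by linarith)]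
      ring
    rw [hU, hFw, plateau_utility (by linarith)]
    ring
  refine ⟨hUw, fun γ hγ hne => ?_, by rw [hUw]; nlinarith⟩
  have hwε : 0 < w * ε := mul_pos (by linarith) hε
  rw [hUw, hU, hF]
  split_ifs with hleft hright
  · obtain ⟨hl, hr⟩ := hleft
    rw [hplateau γ (by linarith) (by linarith), plateau_utility (by linarith)]
    nlinarith
  · obtain ⟨hl, hr⟩ := hright
    have hlt : w < γ := lt_of_le_of_ne hl hne.symm
    rw [hplateau γ (by linarith) (by linarith), plateau_utility (by linarith)]
    nlinarith [mul_pos (sub_pos.2 hlt) (show 0 < γ - 3*ε by linarith)]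
  · rw [hF₀]
    split_ifs with hlow hmid
    · nlinarith [mul_pos (sub_pos.2 hlow) (show 0 < 1 - γ by linarith)]
    · have := plateau_utility (γ := γ) (by linarith) 0
      simp only [sub_zero, mul_zero, add_zero] at this
      rw [this]
      linarith
    · nlinarith [sq_nonneg (γ - 1/2)]
end

section
/- Let X be a finite type and let D₁ and D₂ be probability mass functions on X with squared Hellinger distance h² := (1/2)·∑_{x∈X}(√(D₁(x)) − √(D₂(x)))². Let m ∈ ℕ, let D₁^⊗m and D₂^⊗m denote the m-fold product (i.i.d.) distributions on X^m, and let j : X^m → {1, 2} be any function (a test). Then the average error probability satisfies (1/2)·D₁^⊗m({x ∈ X^m : j(x) = 2}) + (1/2)·D₂^⊗m({x ∈ X^m : j(x) = 1}) ≥ (1/4)·(1 − h²)^{2m}. Moreover, if h² ≤ 1/2, this is at least (1/4)·e^{−4m·h²}. -/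
/-- The total error of a test deciding between `P` and `Q` is at least half the squared
Bhattacharyya coefficient. -/
theorem sq_sum_sqrt_mul_sqrt_le_two_mul_testing_error {Ω : Type*} [Fintype Ω] (P Q : Ω → ℝ)
    (hP : ∀ x, 0 ≤ P x) (hQ : ∀ x, 0 ≤ Q x) (hPsum : ∑ x, P x = 1) (hQsum : ∑ x, Q x = 1)
    (j : Ω → Fin 2) :
    (∑ x, √(P x) * √(Q x)) ^ 2 ≤
      2 * ((∑ x, if j x = 1 then P x else 0) + ∑ x, if j x = 0 then Q x else 0) := by
  rw [← Finset.sum_add_distrib]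
  set e : Ω → ℝ := fun x => (if j x = 1 then P x else 0) + if j x = 0 then Q x else 0
  have he_cases : ∀ x, e x = P x ∨ e x = Q x := fun x => by
    have hj : j x = 0 ∨ j x = 1 := by lia
    rcases hj with hj | hj <;> simp [e, hj]
  have he : ∀ x, 0 ≤ e x := fun x => by
    rcases he_cases x with h | h <;> simp [h, hP, hQ]
  have he_le : ∀ x, 0 ≤ P x + Q x - e x := fun x => by
    rcases he_cases x with h | h <;> simp [h, hP, hQ]
  have hcs := Finset.sum_sq_le_sum_mul_sum_of_sq_le_mul Finset.univ
    (r := fun x => √(P x) * √(Q x)) (f := fun x => P x + Q x - e x) (g := e)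
    (fun x _ => he_le x) (fun x _ => he x) (fun x _ => le_of_eq <| by
      rw [mul_pow, Real.sq_sqrt (hP x), Real.sq_sqrt (hQ x)]
      rcases he_cases x with h | h <;> rw [h] <;> ring)
  have he_sum : 0 ≤ ∑ x, e x := Finset.sum_nonneg fun x _ => he x
  rw [Finset.sum_sub_distrib, Finset.sum_add_distrib, hPsum, hQsum] at hcs
  nlinarith

/-- The Bhattacharyya coefficient is one minus the squared Hellinger distance. -/
theorem sum_sqrt_mul_sqrt_eq_one_sub {X : Type*} [Fintype X] (P Q : X → ℝ)
    (hP : ∀ x, 0 ≤ P x) (hQ : ∀ x, 0 ≤ Q x) (hPsum : ∑ x, P x = 1) (hQsum : ∑ x, Q x = 1) :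
    ∑ x, √(P x) * √(Q x) = 1 - (1 / 2) * ∑ x, (√(P x) - √(Q x)) ^ 2 := by
  have h : ∀ x, (√(P x) - √(Q x)) ^ 2 = P x + Q x - 2 * (√(P x) * √(Q x)) := fun x => by
    rw [sub_sq, Real.sq_sqrt (hP x), Real.sq_sqrt (hQ x)]; ring
  simp only [h, Finset.sum_sub_distrib, Finset.sum_add_distrib, hPsum, hQsum, ← Finset.mul_sum]
  ring

theorem Real.exp_neg_two_mul_le_one_sub {x : ℝ} (h0 : 0 ≤ x) (h : x ≤ 1 / 2) :
    Real.exp (-2 * x) ≤ 1 - x := by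
  rw [neg_mul, Real.exp_neg]
  refine inv_le_of_inv_le₀ (by linarith) ?_
  refine le_trans ?_ (Real.add_one_le_exp (2 * x))
  rw [inv_le_iff_one_le_mul₀ (by linarith)]
  nlinarith

/-- Lower bound on the error probability of any test distinguishing `m` i.i.d. samples of
`D₁` from `m` i.i.d. samples of `D₂` (with a uniform prior over the two hypotheses), in
terms of the squared Hellinger distance `h²` between `D₁` and `D₂`.  Here `j xs = 0` means
the test guesses `D₁` and `j xs = 1` means it guesses `D₂`, so the average error is
`(1/2)·D₁^⊗m(j = 1) + (1/2)·D₂^⊗m(j = 0) ≥ (1/4)(1 − h²)^{2m}`, and moreover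
`≥ (1/4)·exp(−4 m h²)` when `h² ≤ 1/2`. -/
theorem stmt_16 (X : Type*) [Fintype X] (D₁ D₂ : X → ℝ)
    (hD₁_nonneg : ∀ x, 0 ≤ D₁ x) (hD₂_nonneg : ∀ x, 0 ≤ D₂ x)
    (hD₁_sum : ∑ x, D₁ x = 1) (hD₂_sum : ∑ x, D₂ x = 1)
    (hsq : ℝ)
    (hhsq : hsq = (1/2) * ∑ x, (Real.sqrt (D₁ x) - Real.sqrt (D₂ x))^2)
    (m : ℕ) (j : (Fin m → X) → Fin 2) :
    ((1/2) * (∑ xs : Fin m → X, if j xs = 1 then ∏ t, D₁ (xs t) else 0)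
      + (1/2) * (∑ xs : Fin m → X, if j xs = 0 then ∏ t, D₂ (xs t) else 0)
      ≥ (1/4) * (1 - hsq)^(2*m))
    ∧ (hsq ≤ 1/2 →
      (1/2) * (∑ xs : Fin m → X, if j xs = 1 then ∏ t, D₁ (xs t) else 0)
        + (1/2) * (∑ xs : Fin m → X, if j xs = 0 then ∏ t, D₂ (xs t) else 0)
        ≥ (1/4) * Real.exp (-4 * m * hsq)) := by

  have hsum_pow : ∀ D : X → ℝ, ∑ x, D x = 1 → ∑ xs : Fin m → X, ∏ t, D (xs t) = 1 :=
    fun D hD => by rw [← Fintype.sum_pow, hD, one_pow]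
  have hmain := sq_sum_sqrt_mul_sqrt_le_two_mul_testing_error
    (fun xs : Fin m → X => ∏ t, D₁ (xs t)) (fun xs => ∏ t, D₂ (xs t))
    (fun xs => Finset.prod_nonneg fun t _ => hD₁_nonneg (xs t))
    (fun xs => Finset.prod_nonneg fun t _ => hD₂_nonneg (xs t))
    (hsum_pow D₁ hD₁_sum) (hsum_pow D₂ hD₂_sum) j
  have hBC : ∑ xs : Fin m → X, √(∏ t, D₁ (xs t)) * √(∏ t, D₂ (xs t)) = (1 - hsq) ^ m := by
    rw [hhsq, ← sum_sqrt_mul_sqrt_eq_one_sub D₁ D₂ hD₁_nonneg hD₂_nonneg hD₁_sum hD₂_sum,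
      Fintype.sum_pow]
    refine Finset.sum_congr rfl fun xs _ => ?_
    rw [Finset.prod_mul_distrib, Real.sqrt_prod _ fun t _ => hD₁_nonneg (xs t),
      Real.sqrt_prod _ fun t _ => hD₂_nonneg (xs t)]
  rw [hBC, ← pow_mul, mul_comm m 2] at hmain
  refine ⟨by linarith, fun hle => ?_⟩
  have h0 : 0 ≤ hsq := by rw [hhsq]; positivity
  have hexp : Real.exp (-4 * m * hsq) ≤ (1 - hsq) ^ (2 * m) :=
    calc Real.exp (-4 * m * hsq) = Real.exp (-2 * hsq) ^ (2 * m) := by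
          rw [← Real.exp_nat_mul]; push_cast; ring_nf
      _ ≤ (1 - hsq) ^ (2 * m) := by
          gcongr
          exact Real.exp_neg_two_mul_le_one_sub h0 hle
  linarith
end
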